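/- In the setting of the renormalization-group construction (finite nonempty types 𝒳₁,…,𝒳_d, surjective maps T_i : 𝒳_i → 𝒳_{i+1}, positive weights σ₁,…,σ_d with σ̄_i := σ₁+⋯+σ_i, loss L : 𝒳₁ → ℝ, λ ∈ ℝ, iterates Z₁ := ∑_x exp(−(λ/σ₁)L(x)), P¹(x) := exp(−(λ/σ₁)L(x))/Z₁, Uⁱ := pushforward of Pⁱ under T_i, Z_{i+1} := ∑_y Uⁱ(y)^{σ̄_i/σ̄_{i+1}}, P^{i+1}(y) := Uⁱ(y)^{σ̄_i/σ̄_{i+1}}/Z_{i+1}, and P̃^{[λ]}(x) := P^d(x^{(d)})∏_{i=1}^{d−1}Pⁱ(x^{(i)})/Uⁱ(x^{(i+1)}) with x^{(1)}:=x, x^{(i+1)}:=T_i(x^{(i)})), the pmf P̃^{[λ]} is the unique maximizer over all pmfs P on 𝒳₁ of the hierarchical entropy regularization objective ∑_{i=1}^d σ_i H(P^{(i)}) − λ ∑_x P(x)L(x), and the maximum value equals ∑_{i=1}^d σ̄_i log Z_i. -/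

import Mathlib

open Finset

/-- Shannon entropy (natural log) of a pmf on a finite type, with `0 * log 0 = 0`. -/
noncomputable def entropy {α : Type*} [Fintype α] (R : α → ℝ) : ℝ :=
  -∑ x, R x * Real.log (R x)

/-- Relative entropy of finite pmfs: `D(R‖S) = ∑_{x : R x > 0} R x log (R x / S x)`. -/
noncomputable def relEnt {α : Type*} [Fintype α] (R S : α → ℝ) : ℝ :=
  ∑ x ∈ Finset.univ.filter (fun x => 0 < R x), R x * Real.log (R x / S x)

/-- Hierarchical pushforwards: `hpush T P 0 = P` and
`hpush T P (i+1) y = ∑_{x : T i x = y} hpush T P i x`. -/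
noncomputable def hpush {X : ℕ → Type*} [∀ i, Fintype (X i)] [∀ i, DecidableEq (X i)]
    (T : ∀ i, X i → X (i + 1)) (P : X 0 → ℝ) : ∀ i, X i → ℝ
  | 0 => P
  | i + 1 => fun y => ∑ x ∈ Finset.univ.filter (fun x => T i x = y), hpush T P i x

/-- Accumulated hierarchical coefficients `σ̄_i = σ_0 + ⋯ + σ_i` (0-based). -/
noncomputable def sbar (σ : ℕ → ℝ) (i : ℕ) : ℝ := ∑ k ∈ Finset.range (i + 1), σ k

/-- The renormalization-group iterates `Pⁱ`:
`P⁰ x = exp(-(λ/σ₀) L x) / Z₀` and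
`P^{i+1} y = (Uⁱ y)^{σ̄_i/σ̄_{i+1}} / Z_{i+1}`, where `Uⁱ` is the pushforward
of `Pⁱ` under `T i` and `Z`'s are the normalizing constants. -/
noncomputable def RGP {X : ℕ → Type*} [∀ i, Fintype (X i)] [∀ i, DecidableEq (X i)]
    (T : ∀ i, X i → X (i + 1)) (σ : ℕ → ℝ) (L : X 0 → ℝ) (lam : ℝ) : ∀ i, X i → ℝ
  | 0 => fun x => Real.exp (-(lam / σ 0) * L x) / ∑ x', Real.exp (-(lam / σ 0) * L x')
  | i + 1 => fun y =>
      (∑ x ∈ Finset.univ.filter (fun x => T i x = y), RGP T σ L lam i x) ^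
          (sbar σ i / sbar σ (i + 1)) /
        ∑ y', (∑ x ∈ Finset.univ.filter (fun x => T i x = y'), RGP T σ L lam i x) ^
          (sbar σ i / sbar σ (i + 1))

/-- The coarse-grained distribution `Uⁱ`, the pushforward of `Pⁱ` under `T i`. -/
noncomputable def RGU {X : ℕ → Type*} [∀ i, Fintype (X i)] [∀ i, DecidableEq (X i)]
    (T : ∀ i, X i → X (i + 1)) (σ : ℕ → ℝ) (L : X 0 → ℝ) (lam : ℝ)
    (i : ℕ) (y : X (i + 1)) : ℝ :=
  ∑ x ∈ Finset.univ.filter (fun x => T i x = y), RGP T σ L lam i x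

/-- The renormalization-group normalizing constants `Z_i`. -/
noncomputable def RGZ {X : ℕ → Type*} [∀ i, Fintype (X i)] [∀ i, DecidableEq (X i)]
    (T : ∀ i, X i → X (i + 1)) (σ : ℕ → ℝ) (L : X 0 → ℝ) (lam : ℝ) : ℕ → ℝ
  | 0 => ∑ x, Real.exp (-(lam / σ 0) * L x)
  | i + 1 => ∑ y, RGU T σ L lam i y ^ (sbar σ i / sbar σ (i + 1))

/-- The hierarchical trajectory `x^{(i)}` of a point `x`. -/
def liftT {X : ℕ → Type*} (T : ∀ i, X i → X (i + 1)) : ∀ i, X 0 → X i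
  | 0 => id
  | i + 1 => fun x => T i (liftT T i x)

/-- The distribution `P̃^{[λ]}`, obtained by disintegration:
`P̃^{[λ]}(x) = P^{d-1}(x^{(d-1)}) ∏_{i<d-1} Pⁱ(x^{(i)}) / Uⁱ(x^{(i+1)})`. -/
noncomputable def Ptilde {X : ℕ → Type*} [∀ i, Fintype (X i)] [∀ i, DecidableEq (X i)]
    (T : ∀ i, X i → X (i + 1)) (σ : ℕ → ℝ) (L : X 0 → ℝ) (lam : ℝ)
    (d : ℕ) (x : X 0) : ℝ :=
  RGP T σ L lam (d - 1) (liftT T (d - 1) x) *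
    ∏ i ∈ Finset.range (d - 1),
      (RGP T σ L lam i (liftT T i x) / RGU T σ L lam i (liftT T (i + 1) x))

/-- The pushforward of `p` under `f`. -/
noncomputable def pushSum {α β : Type*} [Fintype α] [DecidableEq β] (f : α → β) (p : α → ℝ)
    (y : β) : ℝ :=
  ∑ x ∈ univ.filter (fun x => f x = y), p x

/-- Relative entropy as a sum over the whole type, using `0 * log 0 = 0`. -/
noncomputable def klSum {α : Type*} [Fintype α] (p q : α → ℝ) : ℝ :=
  ∑ x, p x * (Real.log (p x) - Real.log (q x))

section PushSum

variable {α β : Type*} [Fintype α] [DecidableEq β] (f : α → β)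

lemma pushSum_nonneg {p : α → ℝ} (hp : ∀ x, 0 ≤ p x) (y : β) : 0 ≤ pushSum f p y :=
  sum_nonneg fun x _ => hp x

lemma le_pushSum {p : α → ℝ} (hp : ∀ x, 0 ≤ p x) (x : α) : p x ≤ pushSum f p (f x) :=
  single_le_sum (f := p) (fun x _ => hp x) (by simp)

lemma pushSum_pos {p : α → ℝ} (hp : ∀ x, 0 < p x) (hf : Function.Surjective f) (y : β) :
    0 < pushSum f p y := by
  obtain ⟨x, rfl⟩ := hf y
  exact (hp x).trans_le (le_pushSum f (fun x => (hp x).le) x)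

/-- Disintegrating `g` along `f` with the conditional weights of `q` gives a measure that pushes
forward to `g`. -/
lemma pushSum_disintegration {q : α → ℝ} {y : β} (hq : pushSum f q y ≠ 0) (g : β → ℝ) :
    pushSum f (fun x => g (f x) * (q x / pushSum f q (f x))) y = g y := by
  have h : pushSum f (fun x => g (f x) * (q x / pushSum f q (f x))) y =
      pushSum f q y * (g y / pushSum f q y) := by
    conv_rhs => rw [pushSum, sum_mul]
    refine sum_congr rfl fun x hx => ?_
    simp only [← (mem_filter.1 hx).2, pushSum]
    ring
  rw [h]
  field_simp

variable [Fintype β]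

lemma sum_pushSum_mul (p : α → ℝ) (g : β → ℝ) :
    ∑ y, pushSum f p y * g y = ∑ x, p x * g (f x) := by
  rw [← sum_fiberwise univ f]
  refine sum_congr rfl fun y _ => ?_
  rw [pushSum, sum_mul]
  refine sum_congr rfl fun x hx => ?_
  rw [(mem_filter.1 hx).2]

lemma sum_pushSum (p : α → ℝ) : ∑ y, pushSum f p y = ∑ x, p x := by
  simpa using sum_pushSum_mul f p (fun _ => 1)

/-- Chain rule for relative entropy along `f`. -/
lemma klSum_eq_add_klSum_pushSum {p q : α → ℝ} (hp : ∀ x, 0 ≤ p x) (hq : ∀ x, 0 < q x) :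
    klSum p q = klSum p (fun x => pushSum f p (f x) * (q x / pushSum f q (f x))) +
      klSum (pushSum f p) (pushSum f q) := by
  unfold klSum
  rw [sum_pushSum_mul f p (fun y => Real.log (pushSum f p y) - Real.log (pushSum f q y)),
    ← sum_add_distrib]
  refine sum_congr rfl fun x _ => ?_
  rcases (hp x).eq_or_lt with h | h
  · simp [← h]
  have h1 : 0 < pushSum f p (f x) := h.trans_le (le_pushSum f hp x)
  have h2 : 0 < pushSum f q (f x) := (hq x).trans_le (le_pushSum f (fun x => (hq x).le) x)
  rw [Real.log_mul h1.ne' (div_pos (hq x) h2).ne', Real.log_div (hq x).ne' h2.ne']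
  ring

end PushSum

section Gibbs

variable {α : Type*} [Fintype α] {p q : α → ℝ}

lemma sub_lt_mul_log_sub_log {a b : ℝ} (ha : 0 ≤ a) (hb : 0 ≤ b) (hab : b = 0 → a = 0)
    (hne : a ≠ b) : a - b < a * (Real.log a - Real.log b) := by
  rcases ha.eq_or_lt with rfl | ha
  · simpa using hb.lt_of_ne hne
  have hb : 0 < b := hb.lt_of_ne fun h => ha.ne' (hab h.symm)
  have h := Real.log_lt_sub_one_of_pos (div_pos hb ha)
    (fun h => hne ((div_eq_one_iff_eq ha.ne').1 h).symm)
  rw [Real.log_div hb.ne' ha.ne'] at h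
  have h2 := mul_lt_mul_of_pos_left h ha
  have h3 : a * (b / a - 1) = b - a := by field_simp
  linarith

lemma sub_le_mul_log_sub_log {a b : ℝ} (ha : 0 ≤ a) (hb : 0 ≤ b) (hab : b = 0 → a = 0) :
    a - b ≤ a * (Real.log a - Real.log b) := by
  rcases eq_or_ne a b with rfl | hne
  · simp
  · exact (sub_lt_mul_log_sub_log ha hb hab hne).le

/-- Gibbs' inequality. -/
lemma klSum_nonneg (hp : ∀ x, 0 ≤ p x) (hq : ∀ x, 0 ≤ q x) (hpq : ∀ x, q x = 0 → p x = 0)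
    (hsum : ∑ x, p x = ∑ x, q x) : 0 ≤ klSum p q := by
  have h := sum_le_sum fun x (_ : x ∈ univ) => sub_le_mul_log_sub_log (hp x) (hq x) (hpq x)
  rw [sum_sub_distrib, hsum, sub_self] at h
  exact h

lemma eq_of_klSum_eq_zero (hp : ∀ x, 0 ≤ p x) (hq : ∀ x, 0 ≤ q x)
    (hpq : ∀ x, q x = 0 → p x = 0) (hsum : ∑ x, p x = ∑ x, q x) (h0 : klSum p q = 0) :
    p = q := by
  by_contra hne
  obtain ⟨x, hx⟩ := Function.ne_iff.1 hne
  have h := sum_lt_sum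
    (fun x (_ : x ∈ univ) => sub_le_mul_log_sub_log (hp x) (hq x) (hpq x))
    ⟨x, mem_univ x, sub_lt_mul_log_sub_log (hp x) (hq x) (hpq x) hx⟩
  rw [sum_sub_distrib, hsum, sub_self] at h
  exact h.ne' h0

lemma klSum_self (p : α → ℝ) : klSum p p = 0 := by
  simp [klSum]

end Gibbs

section Renormalization

variable {X : ℕ → Type*} [∀ i, Fintype (X i)] [∀ i, DecidableEq (X i)]
  (T : ∀ i, X i → X (i + 1)) (σ : ℕ → ℝ) (L : X 0 → ℝ) (lam : ℝ)

lemma hpush_succ (P : X 0 → ℝ) (i : ℕ) : hpush T P (i + 1) = pushSum (T i) (hpush T P i) := rfl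

lemma RGU_eq_pushSum (i : ℕ) : RGU T σ L lam i = pushSum (T i) (RGP T σ L lam i) := rfl

lemma RGP_succ (i : ℕ) (y : X (i + 1)) : RGP T σ L lam (i + 1) y =
    RGU T σ L lam i y ^ (sbar σ i / sbar σ (i + 1)) / RGZ T σ L lam (i + 1) := rfl

lemma hpush_nonneg {P : X 0 → ℝ} (hP : ∀ x, 0 ≤ P x) : ∀ i x, 0 ≤ hpush T P i x
  | 0 => hP
  | i + 1 => pushSum_nonneg (T i) (hpush_nonneg hP i)

lemma sum_hpush (P : X 0 → ℝ) : ∀ i, ∑ x, hpush T P i x = ∑ x, P x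
  | 0 => rfl
  | i + 1 => (sum_pushSum (T i) (hpush T P i)).trans (sum_hpush P i)

/-- The disintegration of `g` on level `n` down to level `0` along the conditional weights of the
renormalization-group iterates. -/
noncomputable def disintegrate (n : ℕ) (g : X n → ℝ) (x : X 0) : ℝ :=
  g (liftT T n x) *
    ∏ i ∈ range n, (RGP T σ L lam i (liftT T i x) / RGU T σ L lam i (liftT T (i + 1) x))

/-- One step of `disintegrate`. -/
noncomputable def disintegrateStep (n : ℕ) (g : X (n + 1) → ℝ) (x : X n) : ℝ :=
  g (T n x) * (RGP T σ L lam n x / RGU T σ L lam n (T n x))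

lemma disintegrate_succ (n : ℕ) (g : X (n + 1) → ℝ) : disintegrate T σ L lam (n + 1) g =
    disintegrate T σ L lam n (disintegrateStep T σ L lam n g) := by
  funext x
  simp only [disintegrate, disintegrateStep, prod_range_succ, liftT]
  ring

lemma disintegrate_zero (g : X 0 → ℝ) : disintegrate T σ L lam 0 g = g := by
  funext x
  simp [disintegrate, liftT]

lemma hpush_disintegrate (n : ℕ) (hU : ∀ i < n, ∀ y, 0 < RGU T σ L lam i y) (g : X n → ℝ) :
    hpush T (disintegrate T σ L lam n g) n = g := by
  induction n with
  | zero => exact disintegrate_zero T σ L lam g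
  | succ n ih =>
    rw [hpush_succ, disintegrate_succ, ih (fun i hi => hU i (by lia))]
    funext y
    exact pushSum_disintegration (T n) (hU n (by lia) y).ne' g

lemma hpush_disintegrate_eq_step (n : ℕ) (hU : ∀ i < n, ∀ y, 0 < RGU T σ L lam i y)
    (g : X n → ℝ) (i : ℕ) (hi : i < n) :
    hpush T (disintegrate T σ L lam n g) i =
      disintegrateStep T σ L lam i (hpush T (disintegrate T σ L lam n g) (i + 1)) := by
  induction n with
  | zero => lia
  | succ n ih =>
    rcases Nat.lt_succ_iff_lt_or_eq.1 hi with h | rfl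
    · rw [disintegrate_succ]
      exact ih (fun i hi => hU i (by lia)) _ h
    · rw [hpush_disintegrate T σ L lam _ hU, disintegrate_succ,
        hpush_disintegrate T σ L lam _ (fun j hj => hU j (by lia))]

lemma eq_disintegrate_hpush (P : X 0 → ℝ) (n : ℕ)
    (h : ∀ i < n, hpush T P i = disintegrateStep T σ L lam i (hpush T P (i + 1))) :
    P = disintegrate T σ L lam n (hpush T P n) := by
  induction n with
  | zero => exact (disintegrate_zero T σ L lam P).symm
  | succ n ih =>
    rw [disintegrate_succ, ← h n (by lia)]
    exact ih fun i hi => h i (by lia)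

lemma sbar_pos {n : ℕ} (hσ : ∀ i ≤ n, 0 < σ i) {i : ℕ} (hi : i ≤ n) : 0 < sbar σ i :=
  sum_pos (fun k hk => hσ k (by have := mem_range.1 hk; lia)) ⟨0, by simp⟩

variable [∀ i, Nonempty (X i)]

lemma RGP_pos {n : ℕ} (hT : ∀ i < n, Function.Surjective (T i)) :
    ∀ i ≤ n, ∀ x, 0 < RGP T σ L lam i x
  | 0, _, x => div_pos (Real.exp_pos _) (sum_pos (fun _ _ => Real.exp_pos _) univ_nonempty)
  | i + 1, hi, x => by
    have hU := pushSum_pos (T i) (RGP_pos hT i (by lia)) (hT i (by lia))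
    exact div_pos (Real.rpow_pos_of_pos (hU x) _)
      (sum_pos (fun y _ => Real.rpow_pos_of_pos (hU y) _) univ_nonempty)

lemma RGU_pos {n : ℕ} (hT : ∀ i < n, Function.Surjective (T i)) (i : ℕ) (hi : i < n)
    (y : X (i + 1)) : 0 < RGU T σ L lam i y :=
  pushSum_pos (T i) (RGP_pos T σ L lam hT i hi.le) (hT i hi) y

lemma RGZ_pos {n : ℕ} (hT : ∀ i < n, Function.Surjective (T i)) :
    ∀ i ≤ n, 0 < RGZ T σ L lam i
  | 0, _ => sum_pos (fun _ _ => Real.exp_pos _) univ_nonempty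
  | i + 1, hi => sum_pos
      (fun y _ => Real.rpow_pos_of_pos (RGU_pos T σ L lam hT i (by lia) y) _) univ_nonempty

lemma sum_RGP {n : ℕ} (hT : ∀ i < n, Function.Surjective (T i)) :
    ∀ i ≤ n, ∑ x, RGP T σ L lam i x = 1
  | 0, hi => by
    have h := (RGZ_pos T σ L lam hT 0 hi).ne'
    simp only [RGP, ← sum_div]
    exact div_self h
  | i + 1, hi => by
    have h := (RGZ_pos T σ L lam hT (i + 1) hi).ne'
    simp only [RGP_succ, ← sum_div]
    exact div_self h

/-- The suboptimality gap of `P` for the objective with levels `0, …, n`. -/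
noncomputable def gap (P : X 0 → ℝ) (n : ℕ) : ℝ :=
  ∑ i ∈ range n, sbar σ i *
      klSum (hpush T P i) (disintegrateStep T σ L lam i (hpush T P (i + 1))) +
    sbar σ n * klSum (hpush T P n) (RGP T σ L lam n)

lemma objective_add_gap {P : X 0 → ℝ} (hP : ∀ x, 0 ≤ P x) (hP1 : ∑ x, P x = 1) (n : ℕ)
    (hT : ∀ i < n, Function.Surjective (T i)) (hσ : ∀ i ≤ n, 0 < σ i) :
    ∑ i ∈ range (n + 1), σ i * entropy (hpush T P i) - lam * ∑ x, P x * L x +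
        gap T σ L lam P n =
      ∑ i ∈ range (n + 1), sbar σ i * Real.log (RGZ T σ L lam i) := by
  induction n with
  | zero =>
    have hZ := RGZ_pos T σ L lam hT 0 le_rfl
    have h0 : sbar σ 0 = σ 0 := by simp [sbar]
    have hs := hσ 0 le_rfl
    have hlog : ∀ x, Real.log (RGP T σ L lam 0 x) =
        -(lam / σ 0) * L x - Real.log (RGZ T σ L lam 0) := fun x => by
      rw [← Real.log_exp (-(lam / σ 0) * L x), ← Real.log_div (Real.exp_pos _).ne' hZ.ne']
      simp [RGP, RGZ]
    have hkl : klSum P (RGP T σ L lam 0) =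
        -entropy P + lam / σ 0 * ∑ x, P x * L x + Real.log (RGZ T σ L lam 0) := by
      calc klSum P (RGP T σ L lam 0)
          = ∑ x, (P x * Real.log (P x) + lam / σ 0 * (P x * L x) +
              P x * Real.log (RGZ T σ L lam 0)) :=
            sum_congr rfl fun x _ => by rw [hlog]; ring
        _ = _ := by
            rw [sum_add_distrib, sum_add_distrib, ← mul_sum, ← sum_mul, hP1, entropy]; ring
    simp only [gap, zero_add, range_one, sum_singleton, range_zero, sum_empty, h0, hpush, hkl]
    field_simp
    ring
  | succ n ih =>
    have ih := ih (fun i hi => hT i (by lia)) (fun i hi => hσ i (by lia))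
    have hZ := RGZ_pos T σ L lam hT (n + 1) le_rfl
    have hs := sbar_pos σ hσ (le_refl (n + 1))
    have hss : sbar σ (n + 1) = sbar σ n + σ (n + 1) := sum_range_succ _ _
    have hlog : ∀ y, sbar σ (n + 1) * Real.log (RGP T σ L lam (n + 1) y) =
        sbar σ n * Real.log (RGU T σ L lam n y) -
          sbar σ (n + 1) * Real.log (RGZ T σ L lam (n + 1)) := fun y => by
      have hU := RGU_pos T σ L lam hT n (by lia) y
      rw [RGP_succ, Real.log_div (Real.rpow_pos_of_pos hU _).ne' hZ.ne', Real.log_rpow hU]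
      field_simp
    have hchain := klSum_eq_add_klSum_pushSum (T n) (hpush_nonneg T hP n)
      (RGP_pos T σ L lam hT n (by lia))
    rw [← hpush_succ, ← RGU_eq_pushSum] at hchain
    change _ = klSum (hpush T P n)
      (disintegrateStep T σ L lam n (hpush T P (n + 1))) + _ at hchain
    have hp1 : ∑ y, hpush T P (n + 1) y = 1 := (sum_hpush T P (n + 1)).trans hP1
    have hkl : sbar σ (n + 1) * klSum (hpush T P (n + 1)) (RGP T σ L lam (n + 1)) =
        sbar σ n * klSum (hpush T P (n + 1)) (RGU T σ L lam n) -
          σ (n + 1) * entropy (hpush T P (n + 1)) +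
          sbar σ (n + 1) * Real.log (RGZ T σ L lam (n + 1)) := by
      calc sbar σ (n + 1) * klSum (hpush T P (n + 1)) (RGP T σ L lam (n + 1))
          = ∑ y, (sbar σ n * (hpush T P (n + 1) y *
                (Real.log (hpush T P (n + 1) y) - Real.log (RGU T σ L lam n y))) +
              σ (n + 1) * (hpush T P (n + 1) y * Real.log (hpush T P (n + 1) y)) +
              hpush T P (n + 1) y * (sbar σ (n + 1) * Real.log (RGZ T σ L lam (n + 1)))) := by
            rw [klSum, mul_sum]
            refine sum_congr rfl fun y _ => ?_
            linear_combination (-hpush T P (n + 1) y) * hlog y +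
              hpush T P (n + 1) y * Real.log (hpush T P (n + 1) y) * hss
        _ = _ := by
            rw [sum_add_distrib, sum_add_distrib, ← mul_sum, ← mul_sum, ← sum_mul, hp1,
              entropy, klSum]
            ring
    unfold gap at ih ⊢
    rw [sum_range_succ _ (n + 1), sum_range_succ (fun i => sbar σ i * klSum _ _) n,
      sum_range_succ (fun i => sbar σ i * Real.log (RGZ T σ L lam i)) (n + 1)]
    linear_combination ih + hkl - sbar σ n * hchain

section Gap

variable {T σ} {P : X 0 → ℝ} {n : ℕ}

lemma disintegrateStep_nonneg (hT : ∀ i < n, Function.Surjective (T i)) {i : ℕ} (hi : i < n)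
    {g : X (i + 1) → ℝ} (hg : ∀ y, 0 ≤ g y) (x : X i) :
    0 ≤ disintegrateStep T σ L lam i g x :=
  mul_nonneg (hg _) (div_pos (RGP_pos T σ L lam hT i hi.le x) (RGU_pos T σ L lam hT i hi _)).le

lemma hpush_eq_zero_of_disintegrateStep_eq_zero (hT : ∀ i < n, Function.Surjective (T i))
    (hP : ∀ x, 0 ≤ P x) {i : ℕ} (hi : i < n) (x : X i)
    (h : disintegrateStep T σ L lam i (hpush T P (i + 1)) x = 0) : hpush T P i x = 0 := by
  have h' := (mul_eq_zero.1 h).resolve_right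
    (div_pos (RGP_pos T σ L lam hT i hi.le x) (RGU_pos T σ L lam hT i hi _)).ne'
  exact le_antisymm (h' ▸ le_pushSum (T i) (hpush_nonneg T hP i) x) (hpush_nonneg T hP i x)

lemma sum_disintegrateStep (hT : ∀ i < n, Function.Surjective (T i)) {i : ℕ} (hi : i < n)
    (g : X (i + 1) → ℝ) : ∑ x, disintegrateStep T σ L lam i g x = ∑ y, g y := by
  rw [← sum_pushSum (T i)]
  exact sum_congr rfl fun y _ =>
    pushSum_disintegration (T i) (RGU_pos T σ L lam hT i hi y).ne' g

lemma klSum_disintegrateStep_nonneg (hT : ∀ i < n, Function.Surjective (T i))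
    (hP : ∀ x, 0 ≤ P x) {i : ℕ} (hi : i < n) :
    0 ≤ klSum (hpush T P i) (disintegrateStep T σ L lam i (hpush T P (i + 1))) :=
  klSum_nonneg (hpush_nonneg T hP i)
    (disintegrateStep_nonneg L lam hT hi (hpush_nonneg T hP (i + 1)))
    (hpush_eq_zero_of_disintegrateStep_eq_zero L lam hT hP hi)
    (by rw [sum_disintegrateStep L lam hT hi, sum_hpush, sum_hpush])

lemma klSum_RGP_nonneg (hT : ∀ i < n, Function.Surjective (T i)) (hP : ∀ x, 0 ≤ P x)
    (hP1 : ∑ x, P x = 1) : 0 ≤ klSum (hpush T P n) (RGP T σ L lam n) :=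
  klSum_nonneg (hpush_nonneg T hP n) (fun x => (RGP_pos T σ L lam hT n le_rfl x).le)
    (fun x h => absurd h (RGP_pos T σ L lam hT n le_rfl x).ne')
    (by rw [sum_RGP T σ L lam hT n le_rfl, sum_hpush, hP1])

lemma gap_pos (hT : ∀ i < n, Function.Surjective (T i)) (hσ : ∀ i ≤ n, 0 < σ i)
    (hP : ∀ x, 0 ≤ P x) (hP1 : ∑ x, P x = 1)
    (hne : P ≠ disintegrate T σ L lam n (RGP T σ L lam n)) : 0 < gap T σ L lam P n := by
  have h1 : ∀ i ∈ range n, 0 ≤ sbar σ i *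
      klSum (hpush T P i) (disintegrateStep T σ L lam i (hpush T P (i + 1))) := fun i hi =>
    mul_nonneg (sbar_pos σ hσ (mem_range.1 hi).le).le
      (klSum_disintegrateStep_nonneg L lam hT hP (mem_range.1 hi))
  have hs := sbar_pos σ hσ (le_refl n)
  have h2 := mul_nonneg hs.le (klSum_RGP_nonneg (σ := σ) L lam hT hP hP1)
  refine (add_nonneg (sum_nonneg h1) h2).lt_of_ne fun h => hne ?_
  obtain ⟨h3, h4⟩ := (add_eq_zero_iff_of_nonneg (sum_nonneg h1) h2).1 h.symm
  rw [sum_eq_zero_iff_of_nonneg h1] at h3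
  have htop : hpush T P n = RGP T σ L lam n :=
    eq_of_klSum_eq_zero (hpush_nonneg T hP n) (fun x => (RGP_pos T σ L lam hT n le_rfl x).le)
      (fun x h => absurd h (RGP_pos T σ L lam hT n le_rfl x).ne')
      (by rw [sum_RGP T σ L lam hT n le_rfl, sum_hpush, hP1])
      ((mul_eq_zero.1 h4).resolve_left hs.ne')
  rw [← htop]
  refine eq_disintegrate_hpush T σ L lam P n fun i hi => ?_
  exact eq_of_klSum_eq_zero (hpush_nonneg T hP i)
    (disintegrateStep_nonneg L lam hT hi (hpush_nonneg T hP (i + 1)))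
    (hpush_eq_zero_of_disintegrateStep_eq_zero L lam hT hP hi)
    (by rw [sum_disintegrateStep L lam hT hi, sum_hpush, sum_hpush])
    ((mul_eq_zero.1 (h3 i (mem_range.2 hi))).resolve_left (sbar_pos σ hσ hi.le).ne')

lemma gap_disintegrate (hT : ∀ i < n, Function.Surjective (T i)) :
    gap T σ L lam (disintegrate T σ L lam n (RGP T σ L lam n)) n = 0 := by
  have hU := RGU_pos T σ L lam hT
  rw [gap, hpush_disintegrate T σ L lam n hU, klSum_self, mul_zero, add_zero]
  refine sum_eq_zero fun i hi => ?_
  rw [← hpush_disintegrate_eq_step T σ L lam n hU _ i (mem_range.1 hi), klSum_self, mul_zero]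

end Gap

end Renormalization

/-- The pmf `P̃^{[λ]}` is the unique maximizer of the hierarchical entropy
regularization objective `H_{(σ,T)}(P) - λ E_P[L]` over pmfs on `X 0`, and the
maximum value is `∑ σ̄_i log Z_i`. -/
theorem stmt_7 (d : ℕ) (hd : 1 ≤ d) (X : ℕ → Type*) [∀ i, Fintype (X i)]
    [∀ i, Nonempty (X i)] [∀ i, DecidableEq (X i)]
    (T : ∀ i, X i → X (i + 1)) (hT : ∀ i, i < d - 1 → Function.Surjective (T i))
    (σ : ℕ → ℝ) (hσ : ∀ i, i < d → 0 < σ i) (L : X 0 → ℝ) (lam : ℝ) :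
    (∀ x, 0 ≤ Ptilde T σ L lam d x) ∧
    (∑ x, Ptilde T σ L lam d x = 1) ∧
    (∑ i ∈ Finset.range d, σ i * entropy (hpush T (Ptilde T σ L lam d) i) -
        lam * ∑ x, Ptilde T σ L lam d x * L x =
      ∑ i ∈ Finset.range d, sbar σ i * Real.log (RGZ T σ L lam i)) ∧
    ∀ P : X 0 → ℝ, (∀ x, 0 ≤ P x) → (∑ x, P x = 1) → P ≠ Ptilde T σ L lam d →
      ∑ i ∈ Finset.range d, σ i * entropy (hpush T P i) - lam * ∑ x, P x * L x <
        ∑ i ∈ Finset.range d, sbar σ i * Real.log (RGZ T σ L lam i) := by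
  obtain ⟨n, rfl⟩ : ∃ n, d = n + 1 := ⟨d - 1, by lia⟩
  replace hT : ∀ i < n, Function.Surjective (T i) := fun i hi => hT i (by lia)
  replace hσ : ∀ i ≤ n, 0 < σ i := fun i hi => hσ i (by lia)
  have hPt : Ptilde T σ L lam (n + 1) = disintegrate T σ L lam n (RGP T σ L lam n) := rfl
  have hnonneg : ∀ x, 0 ≤ Ptilde T σ L lam (n + 1) x := fun x =>
    mul_nonneg (RGP_pos T σ L lam hT n le_rfl _).le
      (prod_nonneg fun i hi => (div_pos (RGP_pos T σ L lam hT i (mem_range.1 hi).le _)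
        (RGU_pos T σ L lam hT i (mem_range.1 hi) _)).le)
  have hsum : ∑ x, Ptilde T σ L lam (n + 1) x = 1 := by
    rw [← sum_hpush T _ n, hPt, hpush_disintegrate T σ L lam n (RGU_pos T σ L lam hT),
      sum_RGP T σ L lam hT n le_rfl]
  refine ⟨hnonneg, hsum, ?_, fun P hP hP1 hne => ?_⟩
  · rw [← objective_add_gap T σ L lam hnonneg hsum n hT hσ, hPt, gap_disintegrate L lam hT,
      add_zero]
  · rw [← objective_add_gap T σ L lam hP hP1 n hT hσ]
    exact lt_add_of_pos_right _ (gap_pos L lam hT hσ hP hP1 (hPt ▸ hne))
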